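/- Let c_n denote the number of strong-Baxter permutations of size n, and let ρ be the unique real root of the polynomial t³ + t² − 18t − 43 (this cubic has exactly one real root, which lies in the interval (4,5)). Then limsup_{n→∞} (c_n)^{1/n} = ρ + 2; i.e., the growth constant of the strong-Baxter numbers is ρ + 2 ≈ 6.729031538. (Corollary 5.8.) -/

import Mathlib

/-- `f` contains the vincular pattern 2-41-3. -/
def Contains2413 {m : ℕ} (f : Fin m → Fin m) : Prop :=
  ∃ i j j' k : Fin m, (i : ℕ) < (j : ℕ) ∧ (j' : ℕ) = (j : ℕ) + 1 ∧ (j' : ℕ) < (k : ℕ) ∧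
    f j' < f i ∧ f i < f k ∧ f k < f j

/-- `f` contains the vincular pattern 3-14-2. -/
def Contains3142 {m : ℕ} (f : Fin m → Fin m) : Prop :=
  ∃ i j j' k : Fin m, (i : ℕ) < (j : ℕ) ∧ (j' : ℕ) = (j : ℕ) + 1 ∧ (j' : ℕ) < (k : ℕ) ∧
    f j < f k ∧ f k < f i ∧ f i < f j'

/-- `f` contains the vincular pattern 3-41-2. -/
def Contains3412 {m : ℕ} (f : Fin m → Fin m) : Prop :=
  ∃ i j j' k : Fin m, (i : ℕ) < (j : ℕ) ∧ (j' : ℕ) = (j : ℕ) + 1 ∧ (j' : ℕ) < (k : ℕ) ∧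
    f j' < f k ∧ f k < f i ∧ f i < f j

/-- A strong-Baxter permutation avoids 2-41-3, 3-14-2 and 3-41-2. -/
def IsStrongBaxter {n : ℕ} (π : Equiv.Perm (Fin n)) : Prop :=
  ¬ Contains2413 ⇑π ∧ ¬ Contains3142 ⇑π ∧ ¬ Contains3412 ⇑π

/-- The number of strong-Baxter permutations of size `n`. -/
noncomputable def strongBaxterCount (n : ℕ) : ℕ :=
  Nat.card {π : Equiv.Perm (Fin n) // IsStrongBaxter π}

/-- The number of nodes at depth `d` below a node with label `(p, m)` in the generating tree
`(p, m) ⇝ (1, m), …, (p - 1, m), (p, m + 1), (p + 1, 1), …, (p + 1, m)`. -/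
def treeCount : ℕ → ℕ → ℕ → ℕ
  | 0, _, _ => 1
  | d + 1, p, m => ∑ i ∈ Finset.range (p - 1), treeCount d (i + 1) m + treeCount d p (m + 1) +
      ∑ j ∈ Finset.range m, treeCount d (p + 1) (j + 1)

section Rank

open Finset

lemma sum_card_filter_le (B : Finset ℕ) (F : ℕ → ℕ) :
    ∑ a ∈ B, F #{s ∈ B | s ≤ a} = ∑ i ∈ range #B, F (i + 1) := by
  induction B using Finset.induction_on_max with
  | empty => simp
  | insert b B hb ih =>
    have hbB : b ∉ B := fun h => (hb b h).false
    rw [sum_insert hbB, card_insert_of_notMem hbB, sum_range_succ, ← ih, add_comm]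
    congr 1
    · refine sum_congr rfl fun a ha => ?_
      rw [filter_insert, if_neg (hb a ha).not_ge]
    · rw [filter_true_of_mem, card_insert_of_notMem hbB]
      intro s hs
      rcases mem_insert.1 hs with rfl | hs
      · exact le_rfl
      · exact (hb s hs).le

lemma sum_card_filter_ge (B : Finset ℕ) (F : ℕ → ℕ) :
    ∑ a ∈ B, F #{s ∈ B | a ≤ s} = ∑ i ∈ range #B, F (i + 1) := by
  induction B using Finset.induction_on_min with
  | empty => simp
  | insert b B hb ih =>
    have hbB : b ∉ B := fun h => (hb b h).false
    rw [sum_insert hbB, card_insert_of_notMem hbB, sum_range_succ, ← ih, add_comm]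
    congr 1
    · refine sum_congr rfl fun a ha => ?_
      rw [filter_insert, if_neg (hb a ha).not_ge]
    · rw [filter_true_of_mem, card_insert_of_notMem hbB]
      intro s hs
      rcases mem_insert.1 hs with rfl | hs
      · exact le_rfl
      · exact (hb s hs).le

/-- `A'` is the set of active sites obtained from the set `A` of active sites of a permutation with
last value `l` by appending an element at the site `a`. -/
def IsNextSites (l a : ℕ) (A A' : Finset ℕ) : Prop :=
  ∀ s, s ∈ A' ↔ (if s ≤ a then s else s - 1) ∈ A ∧ ¬(a < l ∧ a < s ∧ s ≤ l + 1) ∧ ¬(l < s ∧ s < a)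

variable {l a : ℕ} {A A' : Finset ℕ}

lemma IsNextSites.card_le_of_le (h : IsNextSites l a A A') (hal : a ≤ l) :
    #{s ∈ A' | s ≤ a} = #{s ∈ A | s ≤ a} := by
  congr 1
  ext s
  have := h s
  simp only [mem_filter]
  grind

lemma IsNextSites.card_lt_of_lt (h : IsNextSites l a A A') (hal : a < l) :
    #{s ∈ A' | a < s} = #{s ∈ A | l < s} := by
  rw [← card_image_of_injective {s ∈ A | l < s} (add_left_injective 1)]
  congr 1
  ext s
  have := h s
  simp only [mem_filter, mem_image]
  constructor
  · intro hs
    refine ⟨s - 1, ?_, ?_⟩ <;> grind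
  · rintro ⟨t, ht, rfl⟩
    grind

lemma IsNextSites.card_lt_of_ge (h : IsNextSites l a A A') (hal : l ≤ a) :
    #{s ∈ A' | a < s} = #{s ∈ A | a ≤ s} := by
  rw [← card_image_of_injective {s ∈ A | a ≤ s} (add_left_injective 1)]
  congr 1
  ext s
  have := h s
  simp only [mem_filter, mem_image]
  constructor
  · intro hs
    refine ⟨s - 1, ?_, ?_⟩ <;> grind
  · rintro ⟨t, ht, rfl⟩
    grind

lemma IsNextSites.card_le_of_gt (h : IsNextSites l a A A') (ha : a ∈ A) (hal : l < a) :
    #{s ∈ A' | s ≤ a} = #{s ∈ A | s ≤ l} + 1 := by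
  have : {s ∈ A' | s ≤ a} = insert a {s ∈ A | s ≤ l} := by
    ext s
    have := h s
    simp only [mem_filter, mem_insert]
    grind
  rw [this, card_insert_of_notMem (by grind)]

lemma treeCount_succ_eq_sum (d : ℕ) (hl : l ∈ A) (next : ℕ → Finset ℕ)
    (hnext : ∀ a ∈ A, IsNextSites l a A (next a)) :
    treeCount (d + 1) #{s ∈ A | s ≤ l} #{s ∈ A | l < s} =
      ∑ a ∈ A, treeCount d #{s ∈ next a | s ≤ a} #{s ∈ next a | a < s} := by
  have hsplit : A = insert l ({s ∈ A | s < l}) ∪ {s ∈ A | l < s} := by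
    ext s
    simp only [mem_union, mem_insert, mem_filter]
    grind
  have hdisj : Disjoint (insert l ({s ∈ A | s < l})) {s ∈ A | l < s} := by
    rw [disjoint_left]
    grind
  have hlow : {s ∈ A | s ≤ l} = insert l {s ∈ A | s < l} := by
    ext s
    simp only [mem_insert, mem_filter]
    grind
  have hcard : #{s ∈ A | s ≤ l} = #{s ∈ A | s < l} + 1 := by
    rw [hlow, card_insert_of_notMem (by simp)]
  conv_rhs => rw [hsplit]
  rw [sum_union hdisj, sum_insert (by simp), treeCount]
  congr 1
  · rw [add_comm]
    congr 1
    · rw [(hnext l hl).card_le_of_le le_rfl, (hnext l hl).card_lt_of_ge le_rfl]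
      congr 1
      have : {s ∈ A | l ≤ s} = insert l {s ∈ A | l < s} := by
        ext s
        simp only [mem_insert, mem_filter]
        grind
      rw [this, card_insert_of_notMem (by simp)]
    · rw [hcard, Nat.add_sub_cancel,
        ← sum_card_filter_le _ (fun i => treeCount d i #{s ∈ A | l < s})]
      refine sum_congr rfl fun a ha => ?_
      obtain ⟨haA, hal⟩ := mem_filter.1 ha
      rw [(hnext a haA).card_le_of_le hal.le, (hnext a haA).card_lt_of_lt hal]
      congr 2
      ext s
      simp only [mem_filter]
      grind
  · rw [← sum_card_filter_ge _ (fun i => treeCount d (#{s ∈ A | s ≤ l} + 1) i)]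
    refine sum_congr rfl fun a ha => ?_
    obtain ⟨haA, hal⟩ := mem_filter.1 ha
    rw [(hnext a haA).card_le_of_gt haA hal, (hnext a haA).card_lt_of_ge hal.le]
    congr 2
    ext s
    simp only [mem_filter]
    grind

end Rank

section Append

open Finset

/-- The permutation whose last value is `a` and whose other values are in the same relative order
as those of `σ`. -/
def appendPerm {n : ℕ} (σ : Equiv.Perm (Fin n)) (a : Fin (n + 1)) : Equiv.Perm (Fin (n + 1)) :=
  ((finSuccEquiv' (Fin.last n)).trans σ.optionCongr).trans (finSuccEquiv' a).symm

@[simp]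
lemma appendPerm_castSucc {n : ℕ} (σ : Equiv.Perm (Fin n)) (a : Fin (n + 1)) (i : Fin n) :
    appendPerm σ a i.castSucc = a.succAbove (σ i) := by
  simp [appendPerm, finSuccEquiv'_last_apply_castSucc]

@[simp]
lemma appendPerm_last {n : ℕ} (σ : Equiv.Perm (Fin n)) (a : Fin (n + 1)) :
    appendPerm σ a (Fin.last n) = a := by
  simp [appendPerm]

lemma appendPerm_bijective (n : ℕ) :
    Function.Bijective fun x : Equiv.Perm (Fin n) × Fin (n + 1) => appendPerm x.1 x.2 := by
  rw [Fintype.bijective_iff_injective_and_card]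
  constructor
  · rintro ⟨σ, a⟩ ⟨τ, b⟩ h
    have hab : a = b := by simpa using congrArg (fun f => f (Fin.last n)) h
    subst hab
    have hστ : σ = τ := by
      ext i
      have := congrArg (fun f => f i.castSucc) h
      simp only [appendPerm_castSucc] at this
      rw [Fin.succAbove_right_injective this]
    rw [hστ]
  · simp [Fintype.card_perm, Nat.factorial_succ, mul_comm]

/-- Appending a last element at the site `s` to `σ` creates a forbidden pattern. -/
def KillsSite {n : ℕ} (σ : Equiv.Perm (Fin n)) (s : ℕ) : Prop :=
  ∃ i j j' : Fin n, (i : ℕ) < j ∧ (j' : ℕ) = j + 1 ∧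
    (((σ j' : ℕ) < σ i ∧ (σ i : ℕ) < σ j ∧ (σ j' : ℕ) < s ∧ s ≤ σ j) ∨
      ((σ j : ℕ) < s ∧ s ≤ σ i ∧ (σ i : ℕ) < σ j'))

lemma succAbove_val {n : ℕ} (a : Fin (n + 1)) (v : Fin n) :
    ((a.succAbove v : Fin (n + 1)) : ℕ) = if (v : ℕ) < a then (v : ℕ) else v + 1 := by
  unfold Fin.succAbove
  simp only [Fin.lt_def, Fin.val_castSucc]
  split_ifs <;> simp

/-- `x, y, y', z` is an occurrence of one of the patterns 2-41-3, 3-14-2, 3-41-2, with `y` and `y'`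
playing the roles of the two adjacent entries. -/
def IsForbidden (x y y' z : ℕ) : Prop :=
  (y' < x ∧ x < z ∧ z < y) ∨ (y < z ∧ z < x ∧ x < y') ∨ (y' < z ∧ z < x ∧ x < y)

lemma isStrongBaxter_iff {n : ℕ} (π : Equiv.Perm (Fin n)) :
    IsStrongBaxter π ↔ ∀ i j j' k : Fin n, (i : ℕ) < j → (j' : ℕ) = j + 1 → (j' : ℕ) < k →
      ¬ IsForbidden (π i) (π j) (π j') (π k) := by
  simp only [IsStrongBaxter, Contains2413, Contains3142, Contains3412, Fin.lt_def, not_exists,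
    IsForbidden]
  constructor
  · rintro ⟨h1, h2, h3⟩ i j j' k hij hj hk (h | h | h)
    · exact h1 i j j' k ⟨hij, hj, hk, h⟩
    · exact h2 i j j' k ⟨hij, hj, hk, h⟩
    · exact h3 i j j' k ⟨hij, hj, hk, h⟩
  · intro h
    refine ⟨?_, ?_, ?_⟩ <;> rintro i j j' k ⟨hij, hj, hk, hP⟩
    · exact h i j j' k hij hj hk (.inl hP)
    · exact h i j j' k hij hj hk (.inr (.inl hP))
    · exact h i j j' k hij hj hk (.inr (.inr hP))

lemma isStrongBaxter_appendPerm {n : ℕ} (σ : Equiv.Perm (Fin n)) (a : Fin (n + 1)) :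
    IsStrongBaxter (appendPerm σ a) ↔ IsStrongBaxter σ ∧ ¬ KillsSite σ a := by
  simp only [isStrongBaxter_iff]
  constructor
  · refine fun h => ⟨fun i j j' k hij hj hk hP => ?_, ?_⟩
    · refine h i.castSucc j.castSucc j'.castSucc k.castSucc hij hj hk ?_
      simp only [appendPerm_castSucc, succAbove_val]
      unfold IsForbidden at *
      grind
    · rintro ⟨i, j, j', hij, hj, hP⟩
      refine h i.castSucc j.castSucc j'.castSucc (Fin.last n) hij hj (by simp) ?_
      simp only [appendPerm_castSucc, succAbove_val, appendPerm_last]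
      unfold IsForbidden at *
      grind
  · rintro ⟨h, hs⟩ i j j' k hij hj hk hP
    obtain ⟨i, rfl⟩ := Fin.exists_castSucc_eq.2 (show i ≠ Fin.last n by grind)
    obtain ⟨j, rfl⟩ := Fin.exists_castSucc_eq.2 (show j ≠ Fin.last n by grind)
    obtain ⟨j', rfl⟩ := Fin.exists_castSucc_eq.2 (show j' ≠ Fin.last n by grind)
    simp only [Fin.val_castSucc] at hij hj hk
    cases k using Fin.lastCases with
    | last =>
      refine hs ⟨i, j, j', hij, hj, ?_⟩
      simp only [appendPerm_castSucc, succAbove_val, appendPerm_last] at hP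
      unfold IsForbidden at *
      grind
    | cast k =>
      refine h i j j' k hij hj hk ?_
      simp only [appendPerm_castSucc, succAbove_val] at hP
      unfold IsForbidden at *
      grind

open Classical in
/-- The sites at which a last element can be appended to `σ` without creating a forbidden
pattern. -/
noncomputable def activeSites {n : ℕ} (σ : Equiv.Perm (Fin n)) : Finset ℕ :=
  {s ∈ range (n + 1) | ¬ KillsSite σ s}

lemma mem_activeSites {n : ℕ} {σ : Equiv.Perm (Fin n)} {s : ℕ} :
    s ∈ activeSites σ ↔ s < n + 1 ∧ ¬ KillsSite σ s := by
  simp [activeSites]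

lemma killsSite_appendPerm {n : ℕ} (σ : Equiv.Perm (Fin (n + 1))) (a : Fin (n + 2)) (s : ℕ) :
    KillsSite (appendPerm σ a) s ↔ KillsSite σ (if s ≤ a then s else s - 1) ∨
      ((a : ℕ) < σ (Fin.last n) ∧ a < s ∧ s ≤ σ (Fin.last n) + 1) ∨
      ((σ (Fin.last n) : ℕ) < s ∧ s < a) := by
  constructor
  · rintro ⟨i, j, j', hij, hj, hP⟩
    obtain ⟨i, rfl⟩ := Fin.exists_castSucc_eq.2 (show i ≠ Fin.last _ by grind)
    obtain ⟨j, rfl⟩ := Fin.exists_castSucc_eq.2 (show j ≠ Fin.last _ by grind)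
    simp only [Fin.val_castSucc] at hij hj
    cases j' using Fin.lastCases with
    | last =>
      right
      obtain rfl : j = Fin.last n := by
        ext
        simpa using hj.symm
      simp only [appendPerm_castSucc, succAbove_val, appendPerm_last] at hP
      grind
    | cast j' =>
      left
      refine ⟨i, j, j', hij, hj, ?_⟩
      simp only [appendPerm_castSucc, succAbove_val] at hP
      grind
  · rintro (⟨i, j, j', hij, hj, hP⟩ | ⟨h1, h2, h3⟩ | ⟨h1, h2⟩)
    · refine ⟨i.castSucc, j.castSucc, j'.castSucc, hij, hj, ?_⟩
      simp only [appendPerm_castSucc, succAbove_val]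
      grind
    · have hi : σ (σ.symm ⟨a, by omega⟩) = ⟨a, by omega⟩ := σ.apply_symm_apply _
      set i := σ.symm ⟨a, by omega⟩
      refine ⟨i.castSucc, (Fin.last n).castSucc, Fin.last (n + 1), ?_, by simp, ?_⟩
      · have : i ≠ Fin.last n := by grind
        simpa [Fin.lt_def] using Fin.lt_last_iff_ne_last.2 this
      · simp only [appendPerm_castSucc, succAbove_val, appendPerm_last, hi]
        grind
    · have hi : σ (σ.symm ⟨a - 1, by omega⟩) = ⟨a - 1, by omega⟩ := σ.apply_symm_apply _
      set i := σ.symm ⟨a - 1, by omega⟩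
      refine ⟨i.castSucc, (Fin.last n).castSucc, Fin.last (n + 1), ?_, by simp, ?_⟩
      · have : i ≠ Fin.last n := by grind
        simpa [Fin.lt_def] using Fin.lt_last_iff_ne_last.2 this
      · simp only [appendPerm_castSucc, succAbove_val, appendPerm_last, hi]
        grind

lemma isNextSites_appendPerm {n : ℕ} (σ : Equiv.Perm (Fin (n + 1))) (a : Fin (n + 2)) :
    IsNextSites (σ (Fin.last n)) a (activeSites σ) (activeSites (appendPerm σ a)) := by
  intro s
  rw [mem_activeSites, mem_activeSites, killsSite_appendPerm]
  grind

lemma last_mem_activeSites {n : ℕ} (σ : Equiv.Perm (Fin (n + 1))) (hσ : IsStrongBaxter σ) :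
    (σ (Fin.last n) : ℕ) ∈ activeSites σ := by
  refine mem_activeSites.2 ⟨by omega, ?_⟩
  rintro ⟨i, j, j', hij, hj, hP⟩
  refine (isStrongBaxter_iff σ).1 hσ i j j' (Fin.last n) hij hj ?_ ?_
  · have : j' ≠ Fin.last n := by
      rintro rfl
      have : σ i ≠ σ (Fin.last n) := fun h => by
        have := σ.injective h
        grind
      grind
    simpa [Fin.lt_def] using Fin.lt_last_iff_ne_last.2 this
  · have hi : (σ i : ℕ) ≠ σ (Fin.last n) := fun h => by
      have := σ.injective (Fin.ext h)
      grind
    have hj : (σ j : ℕ) ≠ σ (Fin.last n) := fun h => by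
      have := σ.injective (Fin.ext h)
      grind
    unfold IsForbidden
    grind

open Classical in
lemma sum_treeCount_eq (d n : ℕ) :
    ∑ σ : Equiv.Perm (Fin (n + 1)) with IsStrongBaxter σ,
      treeCount d #{s ∈ activeSites σ | s ≤ (σ (Fin.last n) : ℕ)}
        #{s ∈ activeSites σ | (σ (Fin.last n) : ℕ) < s} = strongBaxterCount (n + 1 + d) := by
  induction d generalizing n with
  | zero => simp [treeCount, strongBaxterCount, Nat.card_eq_fintype_card, Fintype.card_subtype]
  | succ d ih =>
    rw [show n + 1 + (d + 1) = n + 1 + 1 + d by ring, ← ih (n + 1)]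
    calc _ = ∑ σ : Equiv.Perm (Fin (n + 1)) with IsStrongBaxter σ,
          ∑ a : Fin (n + 2) with ¬ KillsSite σ (Fin.val a),
            treeCount d #{s ∈ activeSites (appendPerm σ a) | s ≤ (a : ℕ)}
              #{s ∈ activeSites (appendPerm σ a) | (a : ℕ) < s} := by
          refine sum_congr rfl fun σ hσ => ?_
          rw [treeCount_succ_eq_sum d (last_mem_activeSites σ (mem_filter.1 hσ).2)
            (fun a => if h : a < n + 2 then activeSites (appendPerm σ ⟨a, h⟩) else ∅)]
          · symm
            refine sum_bij (fun a _ => (a : ℕ)) ?_ ?_ ?_ ?_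
            · exact fun a ha => mem_activeSites.2 ⟨a.2, (mem_filter.1 ha).2⟩
            · exact fun a _ b _ h => Fin.ext h
            · intro b hb
              obtain ⟨h1, h2⟩ := mem_activeSites.1 hb
              exact ⟨⟨b, h1⟩, by simpa using h2, rfl⟩
            · intro a _
              simp
          · intro a ha
            have h := (mem_activeSites.1 ha).1
            simpa [h] using isNextSites_appendPerm σ ⟨a, h⟩
      _ = _ := by
          rw [sum_sigma']
          refine sum_bij (fun x _ => appendPerm x.1 x.2) ?_ ?_ ?_ ?_
          · rintro ⟨σ, a⟩ h
            simpa [isStrongBaxter_appendPerm] using h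
          · rintro ⟨σ, a⟩ _ ⟨τ, b⟩ _ h
            have := (appendPerm_bijective (n + 1)).1 (a₁ := (σ, a)) (a₂ := (τ, b)) h
            simp_all
          · intro τ hτ
            obtain ⟨⟨σ, a⟩, rfl⟩ := (appendPerm_bijective (n + 1)).2 τ
            refine ⟨⟨σ, a⟩, ?_, rfl⟩
            simpa [isStrongBaxter_appendPerm] using hτ
          · rintro ⟨σ, a⟩ _
            simp

lemma strongBaxterCount_succ (d : ℕ) : strongBaxterCount (d + 1) = treeCount d 1 1 := by
  classical
  rw [add_comm, ← zero_add 1, ← sum_treeCount_eq d 0]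
  have hK (σ : Equiv.Perm (Fin 1)) (s : ℕ) : ¬ KillsSite σ s := by
    rintro ⟨i, j, j', hij, hj, -⟩
    omega
  have hS (σ : Equiv.Perm (Fin 1)) : IsStrongBaxter σ := by
    rw [isStrongBaxter_iff]
    intro i j j' k hij
    omega
  have hA (σ : Equiv.Perm (Fin 1)) : activeSites σ = {0, 1} := by
    ext s
    simp [mem_activeSites, hK]
    omega
  have h0 : #{s ∈ ({0, 1} : Finset ℕ) | s = 0} = 1 := by decide
  have h1 : #{s ∈ ({0, 1} : Finset ℕ) | 0 < s} = 1 := by decide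
  simp [hS, hA, h0, h1, Fin.val_eq_zero]

end Append

section Growth

open Finset Filter

/-- The real number `v` with `v ^ 3 = v + 1` parametrizes the root of the cubic. -/
lemma exists_cube_eq_add_one {ρ : ℝ} (hroot : ρ ^ 3 + ρ ^ 2 - 18 * ρ - 43 = 0) (h4 : 4 < ρ) :
    ∃ v : ℝ, 1 < v ∧ v < 2 ∧ v ^ 3 = v + 1 ∧ ρ = v ^ 2 + 3 * v - 1 := by
  have hcont : ContinuousOn (fun v : ℝ => v ^ 3 - v) (Set.Icc 1 2) := by fun_prop
  obtain ⟨v, hv, hv3⟩ := intermediate_value_Ioo (by norm_num : (1 : ℝ) ≤ 2) hcont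
    (show (1 : ℝ) ∈ Set.Ioo _ _ by norm_num)
  have hv3 : v ^ 3 = v + 1 := by linarith
  refine ⟨v, hv.1, hv.2, hv3, ?_⟩
  have h1 := hv.1
  set r := v ^ 2 + 3 * v - 1 with hr
  have hr3 : 3 < r := by nlinarith
  have hrr : r ^ 3 + r ^ 2 - 18 * r - 43 = 0 := by
    rw [hr]
    linear_combination (v ^ 3 + 9 * v ^ 2 + 26 * v + 25) * hv3
  have hprod : (ρ - r) * (ρ ^ 2 + ρ * r + r ^ 2 + ρ + r - 18) = 0 := by
    linear_combination hroot - hrr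
  rcases mul_eq_zero.1 hprod with h | h
  · linarith
  · nlinarith

variable {v : ℝ}

lemma treeCount_le (hv1 : 1 < v) (hv3 : v ^ 3 = v + 1) (d p m : ℕ) :
    (treeCount d p m : ℝ) ≤ (v ^ 2 + 3 * v + 1) ^ d * ((v ^ 2) ^ p * (v ^ 3) ^ m) := by
  have ha : (1 : ℝ) ≤ v ^ 2 := one_le_pow₀ hv1.le
  have hb : (1 : ℝ) ≤ v ^ 3 := one_le_pow₀ hv1.le
  have ha' : v * (v ^ 2 - 1) = 1 := by linear_combination hv3
  have hb' : v ^ 3 - 1 = v := by linear_combination hv3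
  induction d generalizing p m with
  | zero => simpa [treeCount] using one_le_mul_of_one_le_of_one_le (one_le_pow₀ ha) (one_le_pow₀ hb)
  | succ d ih =>
    set L := v ^ 2 + 3 * v + 1 with hL
    have hL0 : 0 < L := by positivity
    have hsum1 : ∑ i ∈ range (p - 1), (v ^ 2) ^ (i + 1) ≤ v * (v ^ 2) ^ p := by
      have key (k : ℕ) : ∑ i ∈ range k, (v ^ 2) ^ (i + 1) ≤ v * (v ^ 2) ^ (k + 1) := by
        induction k with
        | zero => simp; positivity
        | succ k ih =>
          rw [sum_range_succ]
          calc _ ≤ v * (v ^ 2) ^ (k + 1) + (v ^ 2) ^ (k + 1) := by gcongr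
            _ = _ := by linear_combination -(v ^ 2) ^ (k + 1) * ha'
      rcases p with _ | p
      · simp; positivity
      · simpa using key p
    have hsum2 : ∑ j ∈ range m, (v ^ 3) ^ (j + 1) ≤ v ^ 2 * (v ^ 3) ^ m := by
      induction m with
      | zero => simp; positivity
      | succ k ih =>
        rw [sum_range_succ]
        calc _ ≤ v ^ 2 * (v ^ 3) ^ k + (v ^ 3) ^ (k + 1) := by gcongr
          _ = _ := by linear_combination -(v ^ 2) * (v ^ 3) ^ k * hb'
    simp only [treeCount]
    push_cast
    calc _ ≤ ∑ i ∈ range (p - 1), L ^ d * ((v ^ 2) ^ (i + 1) * (v ^ 3) ^ m) +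
          L ^ d * ((v ^ 2) ^ p * (v ^ 3) ^ (m + 1)) +
          ∑ j ∈ range m, L ^ d * ((v ^ 2) ^ (p + 1) * (v ^ 3) ^ (j + 1)) := by
          gcongr <;> exact ih _ _
      _ = L ^ d * ((∑ i ∈ range (p - 1), (v ^ 2) ^ (i + 1)) * (v ^ 3) ^ m +
          (v ^ 2) ^ p * (v ^ 3) ^ (m + 1) +
          (v ^ 2) ^ (p + 1) * ∑ j ∈ range m, (v ^ 3) ^ (j + 1)) := by
          rw [← mul_sum, ← sum_mul, ← mul_sum, ← mul_sum]
          ring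
      _ ≤ L ^ d * (v * (v ^ 2) ^ p * (v ^ 3) ^ m + (v ^ 2) ^ p * (v ^ 3) ^ (m + 1) +
          (v ^ 2) ^ (p + 1) * (v ^ 2 * (v ^ 3) ^ m)) := by gcongr
      _ = _ := by
          rw [hL]
          linear_combination L ^ d * (v ^ 2) ^ p * (v ^ 3) ^ m * (1 + v) * hv3

/-- The quadratic bump `R² - (x - c)² - (y - c)²`, with radius `R = c - 1`. -/
def bump (c x y : ℝ) : ℝ := (c - 1) ^ 2 - (x - c) ^ 2 - (y - c) ^ 2

lemma le_sum_bump_left (hv1 : 1 < v) (hv3 : v ^ 3 = v + 1) {c : ℝ} (hc : 1 ≤ c) (k : ℕ) (y : ℝ) :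
    (v ^ 2) ^ (k + 1) * (v * bump c (k + 1) y + 2 * v ^ 4 * (k + 1 - c) - (v ^ 7 + v ^ 5)) ≤
      ∑ i ∈ range k, (v ^ 2) ^ (i + 1) * max 0 (bump c (i + 1) y) := by
  induction k with
  | zero =>
    simp only [range_zero, sum_empty, Nat.cast_zero]
    have h1 : bump c (0 + 1) y ≤ 0 := by
      unfold bump
      nlinarith [sq_nonneg (y - c)]
    have h2 : v ^ 4 * (0 + 1 - c) ≤ 0 :=
      mul_nonpos_of_nonneg_of_nonpos (by positivity) (by linarith)
    refine mul_nonpos_of_nonneg_of_nonpos (by positivity) ?_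
    have : 0 ≤ v ^ 7 + v ^ 5 := by positivity
    nlinarith
  | succ k ih =>
    rw [sum_range_succ]
    refine le_trans (le_of_eq ?_) (add_le_add ih (mul_le_mul_of_nonneg_left (le_max_right 0 _)
      (by positivity)))
    push_cast
    unfold bump
    linear_combination (v ^ 2) ^ (k + 1) * ((c - 1) ^ 2 - (y - c) ^ 2 - (k + 1 - c) ^ 2 +
      2 * v ^ 3 * (k + 1 - c) - v ^ 3 * (v ^ 3 + v - 1)) * hv3

lemma le_sum_bump_right (hv1 : 1 < v) (hv3 : v ^ 3 = v + 1) {c : ℝ} (hc : 1 ≤ c) (k : ℕ) (x : ℝ) :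
    (v ^ 3) ^ k * (v ^ 2 * bump c x k + 2 * v * (k - c) - (v + 2)) ≤
      ∑ j ∈ range k, (v ^ 3) ^ (j + 1) * max 0 (bump c x (j + 1)) := by
  induction k with
  | zero =>
    simp only [range_zero, sum_empty, Nat.cast_zero]
    have h1 : bump c x 0 ≤ 0 := by
      unfold bump
      nlinarith [sq_nonneg (x - c)]
    refine mul_nonpos_of_nonneg_of_nonpos (by positivity) ?_
    have : 0 ≤ v ^ 2 := by positivity
    nlinarith
  | succ k ih =>
    rw [sum_range_succ]
    refine le_trans (le_of_eq ?_) (add_le_add ih (mul_le_mul_of_nonneg_left (le_max_right 0 _)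
      (by positivity)))
    push_cast
    unfold bump
    linear_combination (v ^ 3) ^ k * (v ^ 2 * ((c - 1) ^ 2 - (x - c) ^ 2 - (k - c) ^ 2) -
      2 * v * (v - 1) * (k - c) - v ^ 2 + v - 2) * hv3

/-- A compactly supported subsolution of the recursion of `treeCount`. -/
noncomputable def weightedBump (v c : ℝ) (p m : ℕ) : ℝ :=
  (v ^ 2) ^ p * (v ^ 3) ^ m * max 0 (bump c p m)

lemma weightedBump_nonneg (hv1 : 1 < v) (c : ℝ) (p m : ℕ) : 0 ≤ weightedBump v c p m := by
  unfold weightedBump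
  positivity

set_option maxHeartbeats 1000000 in
lemma exists_subsolution (hv1 : 1 < v) (hv2 : v < 2) (hv3 : v ^ 3 = v + 1) {δ : ℝ} (hδ : 0 < δ) :
    ∃ c : ℕ, 2 ≤ c ∧ ∀ p m : ℕ,
      (v ^ 2 + 3 * v + 1 - δ) * weightedBump v c p m ≤
        ∑ i ∈ range (p - 1), weightedBump v c (i + 1) m + weightedBump v c p (m + 1) +
          ∑ j ∈ range m, weightedBump v c (p + 1) (j + 1) := by
  set L := v ^ 2 + 3 * v + 1 with hL
  have hL0 : 0 < L := by positivity
  set C := v ^ 7 + v ^ 5 + v ^ 4 + 2 * v ^ 3 + 2 * v ^ 2 with hC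
  set K := C / δ with hK
  have hK0 : 0 < K := by positivity
  set M := 2 * L * K + 1 with hM
  have hM1 : 1 < M := lt_add_of_pos_left 1 (by positivity)
  obtain ⟨c, hc⟩ := exists_nat_ge (5 * M ^ 2 + K + 2)
  have hcR : 5 * M ^ 2 + K ≤ ((c : ℝ) - 1) ^ 2 := by nlinarith
  have hc2 : (2 : ℝ) ≤ c := by nlinarith
  refine ⟨c, by exact_mod_cast hc2, fun p m => ?_⟩
  have hf := weightedBump_nonneg hv1 c
  have hs1 : 0 ≤ ∑ i ∈ range (p - 1), weightedBump v c (i + 1) m := sum_nonneg fun i _ => hf _ _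
  have hs2 : 0 ≤ ∑ j ∈ range m, weightedBump v c (p + 1) (j + 1) := sum_nonneg fun i _ => hf _ _
  have hs3 := hf p (m + 1)
  rcases le_or_gt (bump c p m) 0 with hq | hq
  · rw [weightedBump, max_eq_left hq]
    linarith
  have hp : 1 < p := by
    have : (1 : ℝ) < p := by
      unfold bump at hq
      by_contra! h
      nlinarith [sq_nonneg ((m : ℝ) - c)]
    exact_mod_cast this
  have hm : 1 < m := by
    have : (1 : ℝ) < m := by
      unfold bump at hq
      by_contra! h
      nlinarith [sq_nonneg ((p : ℝ) - c)]
    exact_mod_cast this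
  obtain ⟨k, rfl⟩ : ∃ k, p = k + 2 := ⟨p - 2, by omega⟩
  obtain ⟨l, rfl⟩ : ∃ l, m = l + 2 := ⟨m - 2, by omega⟩
  set W := (v ^ 2) ^ (k + 2) * (v ^ 3) ^ (l + 2) with hW
  have hW0 : 0 < W := by positivity
  have hlhs : (L - δ) * weightedBump v c (k + 2) (l + 2) =
      W * ((L - δ) * bump c (k + 2 : ℕ) (l + 2 : ℕ)) := by
    rw [weightedBump, max_eq_right hq.le]
    ring
  rw [hlhs, show k + 2 - 1 = k + 1 by omega] at *
  rcases le_or_gt K (bump c (k + 2 : ℕ) (l + 2 : ℕ)) with hqK | hqK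
  · have h1 := le_sum_bump_left hv1 hv3 (by linarith : (1 : ℝ) ≤ c) (k + 1) (l + 2 : ℕ)
    have h2 := le_sum_bump_right hv1 hv3 (by linarith : (1 : ℝ) ≤ c) (l + 2) (k + 2 + 1 : ℕ)
    have h3 : bump c (k + 2 : ℕ) (l + 2 + 1 : ℕ) ≤ max 0 (bump c (k + 2 : ℕ) (l + 2 + 1 : ℕ)) :=
      le_max_right _ _
    have e1 : ∑ i ∈ range (k + 1), weightedBump v c (i + 1) (l + 2) = (v ^ 3) ^ (l + 2) *
        ∑ i ∈ range (k + 1), (v ^ 2) ^ (i + 1) * max 0 (bump c (i + 1) (l + 2 : ℕ)) := by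
      rw [mul_sum]
      refine sum_congr rfl fun i _ => ?_
      rw [weightedBump]
      push_cast
      ring
    have e2 : ∑ j ∈ range (l + 2), weightedBump v c (k + 2 + 1) (j + 1) = (v ^ 2) ^ (k + 2 + 1) *
        ∑ j ∈ range (l + 2), (v ^ 3) ^ (j + 1) * max 0 (bump c (k + 2 + 1 : ℕ) (j + 1)) := by
      rw [mul_sum]
      refine sum_congr rfl fun i _ => ?_
      rw [weightedBump]
      push_cast
      ring
    have hCq : C ≤ δ * bump c (k + 2 : ℕ) (l + 2 : ℕ) := by
      rw [hK, div_le_iff₀ hδ] at hqK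
      linarith
    calc _ ≤ W * (L * bump c (k + 2 : ℕ) (l + 2 : ℕ) - C) := by
          refine mul_le_mul_of_nonneg_left ?_ hW0.le
          linarith
      _ = (v ^ 3) ^ (l + 2) * ((v ^ 2) ^ (k + 1 + 1) * (v * bump c ((k + 1 : ℕ) + 1) (l + 2 : ℕ) +
            2 * v ^ 4 * ((k + 1 : ℕ) + 1 - c) - (v ^ 7 + v ^ 5))) +
          (v ^ 2) ^ (k + 2) * (v ^ 3) ^ (l + 2 + 1) * bump c (k + 2 : ℕ) (l + 2 + 1 : ℕ) +
          (v ^ 2) ^ (k + 2 + 1) * ((v ^ 3) ^ (l + 2) * (v ^ 2 * bump c (k + 2 + 1 : ℕ) (l + 2 : ℕ) +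
            2 * v * ((l + 2 : ℕ) - c) - (v + 2))) := by
          rw [hW, hL, hC]
          unfold bump
          push_cast
          linear_combination -((v ^ 2) ^ (k + 2) * (v ^ 3) ^ (l + 2)) * (v + 1) *
            (((c : ℝ) - 1) ^ 2 - (k + 2 - c) ^ 2 - (l + 2 - c) ^ 2) * hv3
      _ ≤ _ := by
          rw [e1, e2, weightedBump]
          gcongr
  · have hneg : (L - δ) * bump c (k + 2 : ℕ) (l + 2 : ℕ) ≤ L * K := by nlinarith
    refine (mul_le_mul_of_nonneg_left hneg hW0.le).trans ?_
    have hsingle {p m : ℕ} (hw : W ≤ 4 * ((v ^ 2) ^ p * (v ^ 3) ^ m))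
        (hb : 4 * L * K ≤ bump c p m) : W * (L * K) ≤ weightedBump v c p m := by
      calc _ ≤ 4 * ((v ^ 2) ^ p * (v ^ 3) ^ m) * (L * K) := by gcongr
        _ = (v ^ 2) ^ p * (v ^ 3) ^ m * (4 * L * K) := by ring
        _ ≤ _ := mul_le_mul_of_nonneg_left (le_max_of_le_right hb) (by positivity)
    have hright {j : ℕ} (hj : j ∈ range (l + 2)) : weightedBump v c (k + 2 + 1) (j + 1) ≤
        ∑ j ∈ range (l + 2), weightedBump v c (k + 2 + 1) (j + 1) :=
      single_le_sum (f := fun j => weightedBump v c (k + 2 + 1) (j + 1)) (fun i _ => hf _ _) hj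
    by_cases hX : M ≤ (k + 2 : ℝ) - c
    · have h1 := single_le_sum (f := fun i => weightedBump v c (i + 1) (l + 2))
        (fun i _ => hf _ _) (self_mem_range_succ k)
      have h2 : W * (L * K) ≤ weightedBump v c (k + 1) (l + 2) := by
        refine hsingle ?_ ?_
        · rw [hW, pow_succ (v ^ 2) (k + 1)]
          have : 0 < (v ^ 2) ^ (k + 1) * (v ^ 3) ^ (l + 2) := by positivity
          nlinarith
        · have : bump c (k + 1 : ℕ) (l + 2 : ℕ) =
              bump c (k + 2 : ℕ) (l + 2 : ℕ) + 2 * ((k + 2 : ℝ) - c) - 1 := by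
            unfold bump
            push_cast
            ring
          linarith
      linarith
    by_cases hY : (l + 2 : ℝ) - c ≤ -M
    · have h2 : W * (L * K) ≤ weightedBump v c (k + 2) (l + 2 + 1) := by
        refine hsingle ?_ ?_
        · calc W ≤ W * (4 * v ^ 3) := le_mul_of_one_le_right hW0.le (by linarith)
            _ = _ := by rw [hW]; ring
        · have : bump c (k + 2 : ℕ) (l + 2 + 1 : ℕ) =
              bump c (k + 2 : ℕ) (l + 2 : ℕ) - 2 * ((l + 2 : ℝ) - c) - 1 := by
            unfold bump
            push_cast
            ring
          linarith
      linarith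
    by_cases hX' : (k + 2 : ℝ) - c ≤ -M
    · have h1 := hright (j := l + 1) (by simp)
      have h2 : W * (L * K) ≤ weightedBump v c (k + 2 + 1) (l + 1 + 1) := by
        refine hsingle ?_ ?_
        · rw [hW, pow_succ (v ^ 2) (k + 2)]
          have : 0 < (v ^ 2) ^ (k + 2) * (v ^ 3) ^ (l + 2) := by positivity
          nlinarith
        · have : bump c (k + 2 + 1 : ℕ) (l + 1 + 1 : ℕ) =
              bump c (k + 2 : ℕ) (l + 2 : ℕ) - 2 * ((k + 2 : ℝ) - c) - 1 := by
            unfold bump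
            push_cast
            ring
          linarith
      linarith
    have hXY : M ≤ (l + 2 : ℝ) - c - (k + 2 - c) := by
      by_contra! h
      push Not at hX hY hX'
      have hqM : 5 * M ^ 2 < ((k + 2 : ℝ) - c) ^ 2 + ((l + 2 : ℝ) - c) ^ 2 := by
        unfold bump at hqK
        push_cast at hqK
        linarith
      have h1 : ((k + 2 : ℝ) - c) ^ 2 ≤ M ^ 2 := by
        exact sq_le_sq' (by linarith) (by linarith)
      have h2 : ((l + 2 : ℝ) - c) ^ 2 ≤ (2 * M) ^ 2 := by
        exact sq_le_sq' (by linarith) (by linarith)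
      linarith
    have h1 := hright (j := l) (by simp)
    have h2 : W * (L * K) ≤ weightedBump v c (k + 2 + 1) (l + 1) := by
      refine hsingle ?_ ?_
      · have : 0 < (v ^ 2) ^ (k + 2) * (v ^ 3) ^ (l + 1) := by positivity
        have hle : v ^ 3 ≤ 4 * v ^ 2 := by nlinarith
        calc W = (v ^ 2) ^ (k + 2) * (v ^ 3) ^ (l + 1) * v ^ 3 := by rw [hW]; ring
          _ ≤ (v ^ 2) ^ (k + 2) * (v ^ 3) ^ (l + 1) * (4 * v ^ 2) := by gcongr
          _ = _ := by ring
      · have : bump c (k + 2 + 1 : ℕ) (l + 1 : ℕ) = bump c (k + 2 : ℕ) (l + 2 : ℕ) +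
            2 * ((l + 2 : ℝ) - c - (k + 2 - c)) - 2 := by
          unfold bump
          push_cast
          ring
        linarith
    linarith

lemma weightedBump_le (hv1 : 1 < v) {c : ℝ} (hc : 1 ≤ c) {N : ℕ} (hN : 2 * c ≤ N) (p m : ℕ) :
    weightedBump v c p m ≤ (v ^ 2) ^ N * (v ^ 3) ^ N * c ^ 2 := by
  rcases le_or_gt (bump c p m) 0 with hq | hq
  · rw [weightedBump, max_eq_left hq, mul_zero]
    positivity
  rw [weightedBump, max_eq_right hq.le]
  have hp : p ≤ N := by
    have : (p : ℝ) ≤ N := by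
      unfold bump at hq
      by_contra! h
      nlinarith [sq_nonneg ((m : ℝ) - c)]
    exact_mod_cast this
  have hm : m ≤ N := by
    have : (m : ℝ) ≤ N := by
      unfold bump at hq
      by_contra! h
      nlinarith [sq_nonneg ((p : ℝ) - c)]
    exact_mod_cast this
  have hb : bump c p m ≤ c ^ 2 := by
    unfold bump
    nlinarith [sq_nonneg ((m : ℝ) - c), sq_nonneg ((p : ℝ) - c)]
  gcongr
  · exact one_le_pow₀ hv1.le
  · exact one_le_pow₀ hv1.le

lemma treeCount_add_right_le (d p m j : ℕ) : treeCount d p (m + j) ≤ treeCount (d + j) p m := by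
  induction j generalizing m with
  | zero => rfl
  | succ j ih =>
    calc _ = treeCount d p (m + 1 + j) := by ring_nf
      _ ≤ treeCount (d + j) p (m + 1) := ih _
      _ ≤ treeCount (d + j + 1) p m := by
        rw [treeCount]
        omega

lemma treeCount_add_left_le (d p m j : ℕ) :
    treeCount d (p + j) (m + 1) ≤ treeCount (d + j) p (m + 1) := by
  induction j generalizing p with
  | zero => rfl
  | succ j ih =>
    calc _ = treeCount d (p + 1 + j) (m + 1) := by ring_nf
      _ ≤ treeCount (d + j) (p + 1) (m + 1) := ih _
      _ ≤ treeCount (d + j + 1) p (m + 1) := by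
        rw [treeCount, sum_range_succ]
        omega

lemma exists_le_treeCount (hv1 : 1 < v) (hv2 : v < 2) (hv3 : v ^ 3 = v + 1) {δ : ℝ} (hδ : 0 < δ)
    (hδL : δ < v ^ 2 + 3 * v + 1) :
    ∃ κ : ℝ, 0 < κ ∧ ∃ k : ℕ, ∀ d,
      κ * (v ^ 2 + 3 * v + 1 - δ) ^ d ≤ treeCount (d + k) 1 1 := by
  obtain ⟨c, hc, hsub⟩ := exists_subsolution hv1 hv2 hv3 hδ
  set L := v ^ 2 + 3 * v + 1 - δ
  have hL : 0 < L := sub_pos.2 hδL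
  have hc' : (2 : ℝ) ≤ c := by exact_mod_cast hc
  set B := (v ^ 2) ^ (2 * c) * (v ^ 3) ^ (2 * c) * (c : ℝ) ^ 2
  have hB : 0 < B := by positivity
  have hle (p m : ℕ) : weightedBump v c p m ≤ B :=
    weightedBump_le hv1 (by linarith) (by push_cast; rfl) p m
  have key (d p m : ℕ) : L ^ d * weightedBump v c p m ≤ B * treeCount d p m := by
    induction d generalizing p m with
    | zero => simpa [treeCount] using hle p m
    | succ d ih =>
      calc _ = L ^ d * (L * weightedBump v c p m) := by ring
        _ ≤ L ^ d * (∑ i ∈ range (p - 1), weightedBump v c (i + 1) m +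
            weightedBump v c p (m + 1) + ∑ j ∈ range m, weightedBump v c (p + 1) (j + 1)) := by
          gcongr
          exact hsub p m
        _ = ∑ i ∈ range (p - 1), L ^ d * weightedBump v c (i + 1) m +
            L ^ d * weightedBump v c p (m + 1) +
            ∑ j ∈ range m, L ^ d * weightedBump v c (p + 1) (j + 1) := by
          simp only [mul_add, mul_sum]
        _ ≤ ∑ i ∈ range (p - 1), B * treeCount d (i + 1) m + B * treeCount d p (m + 1) +
            ∑ j ∈ range m, B * treeCount d (p + 1) (j + 1) := by
          exact add_le_add (add_le_add (sum_le_sum fun _ _ => ih _ _) (ih _ _))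
            (sum_le_sum fun _ _ => ih _ _)
        _ = _ := by
          simp only [treeCount, Nat.cast_add, Nat.cast_sum, mul_add, mul_sum]
  have hpos : 0 < weightedBump v c c c := by
    have : 0 < bump c c c := by
      unfold bump
      nlinarith
    rw [weightedBump, max_eq_right this.le]
    positivity
  refine ⟨weightedBump v c c c / B, by positivity, (c - 1) + (c - 1), fun d => ?_⟩
  have hpath : treeCount d c c ≤ treeCount (d + ((c - 1) + (c - 1))) 1 1 := by
    have h1 := treeCount_add_right_le d c 1 (c - 1)
    have h2 := treeCount_add_left_le (d + (c - 1)) 1 0 (c - 1)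
    rw [show 1 + (c - 1) = c by omega] at h1 h2
    rw [← add_assoc]
    exact h1.trans h2
  rw [div_mul_eq_mul_div, div_le_iff₀ hB]
  calc _ = L ^ d * weightedBump v c c c := mul_comm _ _
    _ ≤ B * treeCount d c c := key d c c
    _ ≤ B * treeCount (d + ((c - 1) + (c - 1))) 1 1 := by gcongr
    _ = _ := mul_comm _ _

/-- The `n`-th root of a sequence with exponential growth rate `L` tends to `L`. -/
lemma tendsto_rpow_one_div_of_bounds {c : ℕ → ℝ} (hc : ∀ n, 0 ≤ c n) {L C : ℝ} (hL : 0 < L)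
    (hC : 0 < C) (hupper : ∀ᶠ n in atTop, c n ≤ C * L ^ n)
    (hlower : ∀ r, 0 < r → r < L → ∃ κ : ℝ, 0 < κ ∧ ∀ᶠ n in atTop, κ * r ^ n ≤ c n) :
    Tendsto (fun n : ℕ => c n ^ (1 / (n : ℝ))) atTop (nhds L) := by
  have hroot {κ r : ℝ} (hκ : 0 < κ) (hr : 0 < r) :
      Tendsto (fun n : ℕ => (κ * r ^ n) ^ (1 / (n : ℝ))) atTop (nhds r) := by
    have h1 : Tendsto (fun n : ℕ => κ ^ (1 / (n : ℝ)) * r) atTop (nhds r) := by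
      have h0 : Tendsto (fun n : ℕ => 1 / (n : ℝ)) atTop (nhds 0) :=
        tendsto_one_div_atTop_nhds_zero_nat
      simpa using
        (((Real.continuousAt_const_rpow hκ.ne').tendsto.comp h0).mul_const r)
    refine h1.congr' ?_
    filter_upwards [eventually_ne_atTop 0] with n hn
    rw [Real.mul_rpow hκ.le (by positivity), one_div, Real.pow_rpow_inv_natCast hr.le hn]
  rw [tendsto_order]
  constructor
  · intro b hb
    obtain ⟨r, hr, hrL⟩ := exists_between (max_lt hb hL)
    obtain ⟨κ, hκ, hle⟩ := hlower r ((le_max_right _ _).trans_lt hr) hrL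
    have hr0 : 0 < r := (le_max_right _ _).trans_lt hr
    filter_upwards [hle, (hroot hκ hr0).eventually_const_lt ((le_max_left _ _).trans_lt hr)]
      with n h1 h2
    exact h2.trans_le (Real.rpow_le_rpow (by positivity) h1 (by positivity))
  · intro b hb
    filter_upwards [hupper, (hroot hC hL).eventually_lt_const hb] with n h1 h2
    exact (Real.rpow_le_rpow (hc n) h1 (by positivity)).trans_lt h2

end Growth

/-- Corollary 5.8: the growth constant of the strong-Baxter numbers is `ρ + 2`,
where `ρ` is the unique real root of `t³ + t² − 18t − 43` (which lies in `(4,5)`). -/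
theorem strongBaxter_growth_constant (ρ : ℝ)
    (hroot : ρ ^ 3 + ρ ^ 2 - 18 * ρ - 43 = 0) (h4 : 4 < ρ) (h5 : ρ < 5) :
    Filter.limsup (fun n : ℕ => (strongBaxterCount n : ℝ) ^ (1 / (n : ℝ)))
      Filter.atTop = ρ + 2 := by
  obtain ⟨v, hv1, hv2, hv3, rfl⟩ := exists_cube_eq_add_one hroot h4
  set L := v ^ 2 + 3 * v + 1 with hL
  have hL0 : 0 < L := by positivity
  rw [show v ^ 2 + 3 * v - 1 + 2 = L by rw [hL]; ring]
  refine (tendsto_rpow_one_div_of_bounds (C := v ^ 2 * v ^ 3 / L) (fun n => by positivity) hL0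
    (by positivity) ?_ ?_).limsup_eq
  · filter_upwards [Filter.eventually_ge_atTop 1] with n hn
    obtain ⟨d, rfl⟩ := Nat.exists_eq_add_of_le' hn
    rw [strongBaxterCount_succ]
    refine (treeCount_le hv1 hv3 d 1 1).trans (le_of_eq ?_)
    field_simp
    ring
  · intro r hr hrL
    obtain ⟨κ, hκ, k, hk⟩ := exists_le_treeCount hv1 hv2 hv3 (sub_pos.2 hrL) (by linarith)
    refine ⟨κ / r ^ (k + 1), by positivity, ?_⟩
    filter_upwards [Filter.eventually_ge_atTop (k + 1)] with n hn
    obtain ⟨d, rfl⟩ := Nat.exists_eq_add_of_le' hn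
    rw [← add_assoc, strongBaxterCount_succ]
    refine le_trans (le_of_eq ?_) (hk d)
    rw [← hL, sub_sub_cancel]
    field_simp
    ring
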